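/- arXiv:2101.07652 — 5 statements merged into one kernel-verified Lean document; each statement's English description precedes it below -/
import Mathlib

section
/- Let L be a Leibniz superalgebra over K and M a module over L. For every n ≥ 1, every f ∈ Cⁿ(L;M) homogeneous of degree |f|, and every homogeneous x ∈ L, one has (δⁿf)_x = (−1)^{|x||f|} d_x f − δⁿ⁻¹(f_x). -/
open Finset

section Core

variable (K : Type*) [Field K] (L : Type*) [AddCommGroup L] [Module K L]

/-- A (left) Leibniz superalgebra structure on `L` over the field `K`. -/
structure LeibnizSuperStruct where
  grading : ZMod 2 → Submodule K L
  internal : DirectSum.IsInternal grading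
  bracket : L →ₗ[K] L →ₗ[K] L
  bracket_mem : ∀ {α β : ZMod 2} {a b : L},
    a ∈ grading α → b ∈ grading β → bracket a b ∈ grading (α + β)
  leibniz : ∀ {α β : ZMod 2} {a b : L}, a ∈ grading α → b ∈ grading β → ∀ c : L,
    bracket (bracket a b) c =
      bracket a (bracket b c) - ((-1 : K) ^ (α.val * β.val)) • bracket b (bracket a c)

variable {K L}
variable (S : LeibnizSuperStruct K L) (M : Type*) [AddCommGroup M] [Module K M]

/-- A module over a Leibniz superalgebra. -/
structure LeibnizSuperModule where
  grading : ZMod 2 → Submodule K M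
  internal : DirectSum.IsInternal grading
  lact : L →ₗ[K] M →ₗ[K] M
  ract : M →ₗ[K] L →ₗ[K] M
  lact_mem : ∀ {α β : ZMod 2} {a : L} {m : M},
    a ∈ S.grading α → m ∈ grading β → lact a m ∈ grading (α + β)
  ract_mem : ∀ {α β : ZMod 2} {m : M} {a : L},
    m ∈ grading α → a ∈ S.grading β → ract m a ∈ grading (α + β)
  leibniz_lact : ∀ {α β : ZMod 2} {a b : L}, a ∈ S.grading α → b ∈ S.grading β → ∀ m : M,
    lact (S.bracket a b) m
      = lact a (lact b m) - ((-1 : K) ^ (α.val * β.val)) • lact b (lact a m)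
  leibniz_mid : ∀ {α γ : ZMod 2} {a : L} {m : M}, a ∈ S.grading α → m ∈ grading γ → ∀ b : L,
    ract (lact a m) b
      = lact a (ract m b) - ((-1 : K) ^ (α.val * γ.val)) • ract m (S.bracket a b)
  leibniz_ract : ∀ {γ α : ZMod 2} {m : M} {a : L}, m ∈ grading γ → a ∈ S.grading α → ∀ b : L,
    ract (ract m a) b
      = ract m (S.bracket a b) - ((-1 : K) ^ (γ.val * α.val)) • lact a (ract m b)

variable {M} (MS : LeibnizSuperModule S M)

/-- `f ∈ Cⁿ(L;M)` is homogeneous of degree `φ`. -/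
def IsHomogeneousCochain {n : ℕ} (f : MultilinearMap K (fun _ : Fin n => L) M)
    (φ : ZMod 2) : Prop :=
  ∀ (α : Fin n → ZMod 2) (x : Fin n → L), (∀ i, x i ∈ S.grading (α i)) →
    f x ∈ MS.grading ((∑ i, α i) + φ)

/-- The operator `d_x` (for `x` homogeneous of degree `ξ`) on pointwise `n`-cochains of
degree `ψ`, recorded together with the degrees of the (homogeneous) arguments. -/
def Dop {n : ℕ} (x : L) (ξ ψ : ZMod 2)
    (g : (Fin n → ZMod 2) → (Fin n → L) → M) :
    (Fin n → ZMod 2) → (Fin n → L) → M :=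
  fun α z =>
    MS.lact x (g α z) -
      ∑ i : Fin n,
        ((-1 : K) ^ ((ξ * (ψ + ∑ j ∈ Finset.univ.filter (fun j => j < i), α j)).val)) •
          g (Function.update α i (ξ + α i)) (Function.update z i (S.bracket x (z i)))

/-- The coboundary `δⁿ` on pointwise `n`-cochains of degree `ψ`. -/
def Delta {n : ℕ} (ψ : ZMod 2) (g : (Fin n → ZMod 2) → (Fin n → L) → M) :
    (Fin (n + 1) → ZMod 2) → (Fin (n + 1) → L) → M :=
  fun α x =>
    (∑ j : Fin (n + 1), ∑ i ∈ Finset.univ.filter (fun i => i < j),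
        ((-1 : K) ^ (i.val + 1) *
            (-1 : K) ^ ((α i * ∑ l ∈ Finset.univ.filter (fun l => i < l ∧ l < j), α l).val)) •
          g (i.removeNth (Function.update α j (α i + α j)))
            (i.removeNth (Function.update x j (S.bracket (x i) (x j))))) +
    (∑ i ∈ Finset.univ.filter (fun i : Fin (n + 1) => i.val < n),
        ((-1 : K) ^ i.val *
            (-1 : K) ^ ((α i * (ψ + ∑ l ∈ Finset.univ.filter (fun l => l < i), α l)).val)) •
          MS.lact (x i) (g (i.removeNth α) (i.removeNth x))) +
    ((-1 : K) ^ (n + 1)) • MS.ract (g (Fin.init α) (Fin.init x)) (x (Fin.last n))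

end Core

theorem sgn_mul_aux {K : Type*} [Field K] (a b : ZMod 2) :
    (-1 : K) ^ a.val * (-1 : K) ^ (a + b).val = (-1 : K) ^ b.val := by
  have h : ∀ a b : ZMod 2, (a.val + (a + b).val) % 2 = b.val := by decide
  rw [← pow_add, neg_one_pow_eq_pow_mod_two, h]

section Statements

variable {K : Type*} [Field K] {L : Type*} [AddCommGroup L] [Module K L]
  {M : Type*} [AddCommGroup M] [Module K M]
  (S : LeibnizSuperStruct K L) (MS : LeibnizSuperModule S M)

theorem stmt1 (n : ℕ) (f : MultilinearMap K (fun _ : Fin (n + 1) => L) M) (φ : ZMod 2)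
    (hf : IsHomogeneousCochain S MS f φ)
    (ξ : ZMod 2) (x : L) (hx : x ∈ S.grading ξ)
    (α : Fin (n + 1) → ZMod 2) (z : Fin (n + 1) → L) (hz : ∀ i, z i ∈ S.grading (α i)) :
    Delta S MS φ (fun _ w => f w) (Fin.cons ξ α) (Fin.cons x z)
      = ((-1 : K) ^ ((ξ * φ).val)) • Dop S MS x ξ φ (fun _ w => f w) α z
        - Delta S MS (φ + ξ) (fun _ w => f (Fin.cons x w)) α z := by
  have hrem : ∀ (i : Fin (n + 1)) (a : L) (w : Fin (n + 1) → L),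
      Fin.removeNth (α := fun _ => L) i.succ (Fin.cons (α := fun _ => L) a w)
        = Fin.cons (α := fun _ => L) a (i.removeNth w) := by
    intro i a w
    funext k
    refine Fin.cases ?_ (fun k => ?_) k <;> simp [Fin.removeNth]
  have hinit : Fin.init (α := fun _ => L) (Fin.cons (α := fun _ => L) x z)
      = Fin.cons (α := fun _ => L) x (Fin.init z) := by
    funext k
    refine Fin.cases ?_ (fun k => ?_) k
    · rfl
    · rfl
  have hupd : ∀ (j : Fin (n + 1)) (b : L),
      Function.update (Fin.cons (α := fun _ => L) x z) j.succ b
        = Fin.cons (α := fun _ => L) x (Function.update z j b) := by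
    intro j b
    rw [Fin.cons_update]
  have hlast : Fin.cons (α := fun _ => L) x z (Fin.last (n + 1)) = z (Fin.last n) := rfl
  have hr0 : ∀ w : Fin (n + 1) → L,
      Fin.removeNth (α := fun _ => L) 0 (Fin.cons (α := fun _ => L) x w) = w := by
    intro w
    funext k
    simp [Fin.removeNth]
  -- split all sums at the first index
  unfold Delta Dop
  simp only [Finset.sum_filter, hlast, hinit]
  rw [Fin.sum_univ_succ (n := n + 1), Fin.sum_univ_succ (n := n + 1)]
  simp only [Fin.sum_univ_succ (n := n + 1), Fin.cons_succ, Fin.cons_zero, hupd, hrem, hr0,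
    Fin.succ_lt_succ_iff, Fin.succ_pos, Fin.not_lt_zero, Fin.val_succ, Fin.val_zero,
    if_true, if_false, lt_irrefl, false_and, true_and, zero_add, add_lt_add_iff_right,
    Finset.sum_const_zero, add_zero, Nat.succ_pos, pow_zero, one_mul, pow_one,
    Finset.sum_add_distrib, smul_sub, Finset.smul_sum, smul_smul, mul_add, sgn_mul_aux]
  have hs : ∀ m : ℕ, (-1 : K) ^ (m + 1) = -(-1 : K) ^ m := fun m => by rw [pow_succ]; ring
  simp only [hs, neg_mul, neg_smul, add_assoc]
  have hs2 : ∀ m : ℕ, (-1 : K) ^ (m + (1 + 1)) = (-1 : K) ^ m := fun m => by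
    rw [← add_assoc, hs, hs, neg_neg]
  have hite : ∀ (p : Prop) [Decidable p] (m : M),
      (if p then -m else 0) = -(if p then m else 0) := by
    intro p _ m
    split_ifs <;> simp
  simp only [hs2, hite, Finset.sum_neg_distrib, one_mul, mul_zero, add_zero]
  abel

end Statements
end

section
/- Let L be a Leibniz superalgebra over K and M a module over L. For every n ≥ 0, every f ∈ Cⁿ(L;M) homogeneous of degree |f|, and every homogeneous x ∈ L, one has δⁿ(d_x f) = d_x(δⁿ f). -/
open Finset

section Helpers

/-- the sign character -/
def chi (K : Type*) [Field K] (a : ZMod 2) : K := (-1 : K) ^ a.val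

theorem chi_add (K : Type*) [Field K] (a b : ZMod 2) : chi K (a + b) = chi K a * chi K b := by
  unfold chi
  rw [← pow_add, ZMod.val_add]
  exact (neg_one_pow_eq_pow_mod_two _).symm

theorem chi_mul (K : Type*) [Field K] (a b : ZMod 2) :
    (-1 : K) ^ (a.val * b.val) = chi K (a * b) := by
  unfold chi
  rw [ZMod.val_mul]
  exact (neg_one_pow_eq_pow_mod_two _)

theorem sign_aux (K : Type*) [Field K] (c : K) {a b d e : ZMod 2} (h : a + b = d + e) :
    c * chi K a * chi K b = chi K d * (c * chi K e) := by
  have := congrArg (chi K) h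
  rw [chi_add, chi_add] at this
  linear_combination c * this

theorem sum_update_filter {m : ℕ} (p : Fin m → Prop) [DecidablePred p] (γ : Fin m → ZMod 2)
    (j : Fin m) (v : ZMod 2) :
    ∑ l ∈ Finset.univ.filter p, Function.update γ j v l
      = ∑ l ∈ Finset.univ.filter p, γ l + if p j then v + γ j else 0 := by
  rw [Finset.sum_filter, Finset.sum_filter, ← Finset.add_sum_erase _ _ (Finset.mem_univ j),
    ← Finset.add_sum_erase (a := j) _ (fun l => if p l then γ l else 0) (Finset.mem_univ j)]
  have : ∑ l ∈ Finset.univ.erase j, (if p l then Function.update γ j v l else 0)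
      = ∑ l ∈ Finset.univ.erase j, (if p l then γ l else 0) := by
    refine Finset.sum_congr rfl fun l hl => ?_
    rw [Function.update_of_ne (Finset.ne_of_mem_erase hl)]
  rw [this, Function.update_self]
  have h2 : γ j + γ j = 0 := CharTwo.add_self_eq_zero _
  split_ifs <;> grind

theorem sum_removeNth_filter {m : ℕ} (γ : Fin (m + 1) → ZMod 2) (i : Fin (m + 1)) (k : Fin m) :
    ∑ l ∈ Finset.univ.filter (fun l => l < k), i.removeNth γ l
      = ∑ l ∈ Finset.univ.filter (fun l => l < i.succAbove k), γ l
        + if i < i.succAbove k then γ i else 0 := by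
  rw [Finset.sum_filter, Finset.sum_filter, Fin.sum_univ_succAbove _ i]
  simp only [Fin.succAbove_lt_succAbove_iff, Fin.removeNth]
  have h2 : γ i + γ i = 0 := CharTwo.add_self_eq_zero _
  split_ifs <;> grind

theorem sum_between {m : ℕ} (γ : Fin m → ZMod 2) (i j : Fin m) (h : i < j) :
    ∑ l ∈ Finset.univ.filter (fun l => i < l ∧ l < j), γ l
      = ∑ l ∈ Finset.univ.filter (fun l => l < j), γ l
        + ∑ l ∈ Finset.univ.filter (fun l => l < i), γ l + γ i := by
  have e : Finset.univ.filter (fun l => l < j)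
      = (Finset.univ.filter (fun l => i < l ∧ l < j)) ∪
        ((Finset.univ.filter (fun l => l < i)) ∪ {i}) := by
    ext l; simp only [Finset.mem_filter, Finset.mem_univ, true_and, Finset.mem_union,
      Finset.mem_singleton]; grind
  rw [e, Finset.sum_union, Finset.sum_union, Finset.sum_singleton]
  · generalize ∑ l ∈ Finset.univ.filter (fun l => l < i), γ l = P
    have h2 : γ i + γ i = 0 := CharTwo.add_self_eq_zero _
    have h3 : P + P = 0 := CharTwo.add_self_eq_zero _
    linear_combination (-1) * h2 - h3
  · rw [Finset.disjoint_left]; simp only [Finset.mem_filter, Finset.mem_univ, true_and,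
      Finset.mem_singleton]; grind
  · rw [Finset.disjoint_left]; simp only [Finset.mem_filter, Finset.mem_univ, true_and, Finset.mem_union,
      Finset.mem_singleton]; grind

variable {K : Type*} [Field K] {L : Type*} [AddCommGroup L] [Module K L]
  {M : Type*} [AddCommGroup M] [Module K M]
  (S : LeibnizSuperStruct K L) (MS : LeibnizSuperModule S M)

theorem Dop_add {n : ℕ} (x : L) (ξ ψ : ZMod 2) (g h : (Fin n → ZMod 2) → (Fin n → L) → M)
    (α : Fin n → ZMod 2) (z : Fin n → L) :
    Dop S MS x ξ ψ (fun a w => g a w + h a w) α z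
      = Dop S MS x ξ ψ g α z + Dop S MS x ξ ψ h α z := by
  simp only [Dop, map_add, smul_add, Finset.sum_add_distrib]
  abel

theorem Dop_sum {ι : Type*} {n : ℕ} (s : Finset ι) (x : L) (ξ ψ : ZMod 2)
    (g : ι → (Fin n → ZMod 2) → (Fin n → L) → M)
    (α : Fin n → ZMod 2) (z : Fin n → L) :
    Dop S MS x ξ ψ (fun a w => ∑ i ∈ s, g i a w) α z
      = ∑ i ∈ s, Dop S MS x ξ ψ (g i) α z := by
  simp only [Dop, map_sum, Finset.smul_sum, Finset.sum_sub_distrib]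
  rw [Finset.sum_comm]

theorem term_one (n : ℕ) (f : MultilinearMap K (fun _ : Fin n => L) M) (φ : ZMod 2)
    (ξ : ZMod 2) (x : L) (hx : x ∈ S.grading ξ)
    (α : Fin (n + 1) → ZMod 2) (z : Fin (n + 1) → L) (hz : ∀ i, z i ∈ S.grading (α i))
    (i j : Fin (n + 1)) (hij : i < j) :
    ((-1 : K) ^ (i.val + 1) *
            (-1 : K) ^ ((α i * ∑ l ∈ Finset.univ.filter (fun l => i < l ∧ l < j), α l).val)) •
          (Dop S MS x ξ φ (fun _ w => f w)) (i.removeNth (Function.update α j (α i + α j)))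
            (i.removeNth (Function.update z j (S.bracket (z i) (z j))))
      = Dop S MS x ξ φ (fun α x => ((-1 : K) ^ (i.val + 1) *
            (-1 : K) ^ ((α i * ∑ l ∈ Finset.univ.filter (fun l => i < l ∧ l < j), α l).val)) •
          f (i.removeNth (Function.update x j (S.bracket (x i) (x j))))) α z := by
  obtain ⟨j, rfl⟩ := Fin.exists_succAbove_eq hij.ne'
  have hx' := fun a => S.leibniz hx (hz i) a
  simp only [← chi.eq_1, chi_mul] at *
  simp only [Dop, ← chi.eq_1]
  rw [Fin.sum_univ_succAbove _ i, smul_sub, map_smul, sub_right_inj, Finset.smul_sum,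
    ← Finset.add_sum_erase _ _ (Finset.mem_univ j),
    ← Finset.add_sum_erase (a := j) Finset.univ (fun k => chi K (ξ * (φ + ∑ l ∈ Finset.univ.filter (fun l => l < i.succAbove k), α l)) • _) (Finset.mem_univ j), ← add_assoc]
  congr 1
  · simp only [Fin.removeNth_update_succAbove, Fin.removeNth_update, Function.update_idem,
      Function.update_self, ne_eq, Fin.succAbove_ne, Fin.ne_succAbove, not_false_eq_true,
      Function.update_of_ne, sum_update_filter, sum_removeNth_filter, hij, lt_irrefl, if_true, if_false, sum_between _ _ _ hij, smul_smul]
    have e := hx' (z (i.succAbove j))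
    rw [eq_sub_iff_add_eq] at e
    rw [← e, MultilinearMap.map_update_add, MultilinearMap.map_update_smul, smul_add, smul_smul]
    generalize ∑ l ∈ Finset.univ.filter (fun l => l < i), α l = P
    generalize ∑ l ∈ Finset.univ.filter (fun l => l < i.succAbove j), α l = Q
    generalize α i = a
    generalize α (i.succAbove j) = b
    congr 2
    · refine sign_aux K _ ?_
      clear e hx hx' hz
      revert P Q a b φ ξ
      decide
    · rw [if_neg hij.not_gt, mul_assoc, ← chi_add]
      refine sign_aux K _ ?_
      clear e hx hx' hz
      revert P Q a b φ ξ
      decide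
  · refine Finset.sum_congr rfl fun k hk => ?_
    have hk' : k ≠ j := Finset.ne_of_mem_erase hk
    have hk2 : i.succAbove k ≠ i.succAbove j := fun h => hk' (Fin.succAbove_right_injective h)
    have hk3 : i.succAbove j ≠ i.succAbove k := fun h => hk2 h.symm
    simp only [Fin.removeNth_update_succAbove, ne_eq,
      Fin.ne_succAbove, not_false_eq_true, Function.update_of_ne, hk3, hk', smul_smul,
      sum_update_filter, sum_removeNth_filter, Function.update_comm (Ne.symm hk')]
    congr 1
    refine sign_aux K _ ?_
    have hik : i ≠ i.succAbove k := Fin.ne_succAbove i k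
    simp only [← Fin.succAbove_lt_succAbove_iff (p := i) (i := j) (j := k), Fin.removeNth]
    generalize ∑ l ∈ Finset.univ.filter (fun l => l < i.succAbove k), α l = P
    generalize ∑ l ∈ Finset.univ.filter (fun l => i < l ∧ l < i.succAbove j), α l = Q
    generalize α (i.succAbove j) = b
    generalize α (i.succAbove k) = c
    generalize α i = a
    generalize i.succAbove k = k' at *
    generalize i.succAbove j = j' at *
    have : (i < k' ∧ ¬ j' < k' ∧ k' < j') ∨ (¬ i < k' ∧ ¬ j' < k') ∨
      (i < k' ∧ j' < k' ∧ ¬ k' < j') := by grind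
    clear hx hx' hz hk hk'
    rcases this with ⟨h1, h2, h3⟩ | ⟨h1, h2⟩ | ⟨h1, h2, h3⟩
    · simp only [h1, h2, h3, and_self, if_true, if_false]
      clear h1 h2 h3 hij hk2 hk3 hik
      revert P Q a b c φ ξ
      decide
    · simp only [h1, h2, false_and, if_false]
      clear h1 h2 hij hk2 hk3 hik
      revert P Q a b c φ ξ
      decide
    · simp only [h1, h2, h3, and_false, if_true, if_false]
      clear h1 h2 h3 hij hk2 hk3 hik
      revert P Q a b c φ ξ
      decide

theorem term_two (n : ℕ) (f : MultilinearMap K (fun _ : Fin n => L) M) (φ : ZMod 2)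
    (ξ : ZMod 2) (x : L) (hx : x ∈ S.grading ξ)
    (α : Fin (n + 1) → ZMod 2) (z : Fin (n + 1) → L) (hz : ∀ i, z i ∈ S.grading (α i))
    (i : Fin (n + 1)) :
    ((-1 : K) ^ i.val *
            (-1 : K) ^ ((α i * (φ + ξ + ∑ l ∈ Finset.univ.filter (fun l => l < i), α l)).val)) •
          MS.lact (z i) ((Dop S MS x ξ φ (fun _ w => f w)) (i.removeNth α) (i.removeNth z))
      = Dop S MS x ξ φ (fun α x => ((-1 : K) ^ i.val *
            (-1 : K) ^ ((α i * (φ + ∑ l ∈ Finset.univ.filter (fun l => l < i), α l)).val)) •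
          MS.lact (x i) (f (i.removeNth x))) α z := by
  have e := MS.leibniz_lact hx (hz i) (f (i.removeNth z))
  simp only [← chi.eq_1, chi_mul] at *
  simp only [Dop, ← chi.eq_1]
  rw [Fin.sum_univ_succAbove _ i, map_sub, smul_sub, map_smul, map_sum, Finset.smul_sum,
    ← sub_sub]
  congr 1
  · simp only [Fin.removeNth_update, Function.update_self, sum_update_filter, lt_irrefl, if_false,
      e, smul_sub, smul_smul]
    generalize ∑ l ∈ Finset.univ.filter (fun l => l < i), α l = P
    generalize α i = a
    have h1 : chi K (ξ * (φ + P)) * ((-1) ^ i.val * chi K ((ξ + a) * (φ + (P + 0))))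
        = (-1) ^ i.val * chi K (a * (φ + P)) := by
      have : chi K (a * (φ + P)) = chi K (ξ * (φ + P)) * chi K ((ξ + a) * (φ + (P + 0))) := by
        rw [← chi_add]
        congr 1
        clear e hx hz
        revert φ P ξ a
        decide
      rw [this]; ring
    have h2 : (-1) ^ i.val * chi K (a * (φ + P)) * chi K (ξ * a)
        = (-1) ^ i.val * chi K (a * (φ + ξ + P)) := by
      rw [mul_assoc, ← chi_add]
      congr 2
      clear e hx hz h1
      revert φ P ξ a
      decide
    rw [← mul_assoc (chi K _) _ (chi K (ξ * a)), h1, h2]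
    abel
  · refine Finset.sum_congr rfl fun k _ => ?_
    have hik : i ≠ i.succAbove k := Fin.ne_succAbove i k
    simp only [Fin.removeNth_update_succAbove, ne_eq, Fin.ne_succAbove, not_false_eq_true,
      Function.update_of_ne, smul_smul, map_smul,
      sum_update_filter, sum_removeNth_filter]
    congr 1
    refine sign_aux K _ ?_
    generalize ∑ l ∈ Finset.univ.filter (fun l => l < i.succAbove k), α l = P
    generalize ∑ l ∈ Finset.univ.filter (fun l => l < i), α l = Q
    generalize α (i.succAbove k) = c
    clear e hx hz
    generalize α i = a
    rcases lt_or_gt_of_ne hik with h | h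
    · simp only [h, h.not_gt, if_true, if_false]
      clear h hik
      revert P Q a c φ ξ
      decide
    · simp only [h, h.not_gt, if_true, if_false]
      clear h hik
      revert P Q a c φ ξ
      decide

theorem term_three (n : ℕ) (f : MultilinearMap K (fun _ : Fin n => L) M) (φ : ZMod 2)
    (hf : IsHomogeneousCochain S MS f φ)
    (ξ : ZMod 2) (x : L) (hx : x ∈ S.grading ξ)
    (α : Fin (n + 1) → ZMod 2) (z : Fin (n + 1) → L) (hz : ∀ i, z i ∈ S.grading (α i)) :
    ((-1 : K) ^ (n + 1)) • MS.ract ((Dop S MS x ξ φ (fun _ w => f w)) (Fin.init α) (Fin.init z))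
        (z (Fin.last n))
      = Dop S MS x ξ φ (fun _ x => ((-1 : K) ^ (n + 1)) • MS.ract (f (Fin.init x))
          (x (Fin.last n))) α z := by
  have e := MS.leibniz_mid hx (hf (Fin.init α) (Fin.init z) (fun i => hz i.castSucc))
    (z (Fin.last n))
  simp only [chi_mul] at *
  simp only [Dop, ← chi.eq_1]
  have hP : ∀ k : Fin n, ∑ l ∈ Finset.univ.filter (fun l => l < k.castSucc), α l
      = ∑ l ∈ Finset.univ.filter (fun l => l < k), Fin.init α l := by
    intro k
    rw [Finset.sum_filter, Finset.sum_filter, Fin.sum_univ_castSucc]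
    simp [Fin.init, Fin.le_last, not_lt.mpr]
  have hQ : ∑ l ∈ Finset.univ.filter (fun l => l < Fin.last n), α l = ∑ l, Fin.init α l := by
    rw [Finset.sum_filter, Fin.sum_univ_castSucc]
    simp [Fin.init, Fin.castSucc_lt_last]
  rw [Fin.sum_univ_castSucc]
  simp only [Fin.init_update_last, Fin.init_update_castSucc, Function.update_self, hP, hQ,
    ne_eq, (Fin.castSucc_lt_last _).ne', not_false_eq_true, Function.update_of_ne,
    map_sub, LinearMap.sub_apply, e, map_sum, LinearMap.sum_apply, map_smul, LinearMap.smul_apply,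
    smul_sub, Finset.smul_sum, smul_smul]
  rw [add_comm (∑ l, Fin.init α l) φ, mul_comm ((-1 : K) ^ (n + 1)), ← sub_sub, sub_right_comm]
  congr 2
  refine Finset.sum_congr rfl fun k _ => ?_
  rw [mul_comm]
  rfl

end Helpers

section Statements


variable {K : Type*} [Field K] {L : Type*} [AddCommGroup L] [Module K L]
  {M : Type*} [AddCommGroup M] [Module K M]
  (S : LeibnizSuperStruct K L) (MS : LeibnizSuperModule S M)

theorem stmt3 (n : ℕ) (f : MultilinearMap K (fun _ : Fin n => L) M) (φ : ZMod 2)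
    (hf : IsHomogeneousCochain S MS f φ)
    (ξ : ZMod 2) (x : L) (hx : x ∈ S.grading ξ)
    (α : Fin (n + 1) → ZMod 2) (z : Fin (n + 1) → L) (hz : ∀ i, z i ∈ S.grading (α i)) :
    Delta S MS (φ + ξ) (Dop S MS x ξ φ (fun _ w => f w)) α z
      = Dop S MS x ξ φ (Delta S MS φ (fun _ w => f w)) α z := by
  have hR : Delta S MS φ (fun _ w => f w) = fun α x =>
    ((∑ j : Fin (n + 1), ∑ i ∈ Finset.univ.filter (fun i => i < j),
        ((-1 : K) ^ (i.val + 1) *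
            (-1 : K) ^ ((α i * ∑ l ∈ Finset.univ.filter (fun l => i < l ∧ l < j), α l).val)) •
          f (i.removeNth (Function.update x j (S.bracket (x i) (x j))))) +
    (∑ i ∈ Finset.univ.filter (fun i : Fin (n + 1) => i.val < n),
        ((-1 : K) ^ i.val *
            (-1 : K) ^ ((α i * (φ + ∑ l ∈ Finset.univ.filter (fun l => l < i), α l)).val)) •
          MS.lact (x i) (f (i.removeNth x)))) +
    ((-1 : K) ^ (n + 1)) • MS.ract (f (Fin.init x)) (x (Fin.last n)) := rfl
  rw [hR, Dop_add, Dop_add, Dop_sum, Dop_sum, ← term_three S MS n f φ hf ξ x hx α z hz]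
  unfold Delta
  congr 2
  · refine Finset.sum_congr rfl fun j _ => ?_
    rw [Dop_sum]
    refine Finset.sum_congr rfl fun i hi => ?_
    exact term_one S MS n f φ ξ x hx α z hz i j (Finset.mem_filter.mp hi).2
  · refine Finset.sum_congr rfl fun i _ => ?_
    exact term_two S MS n f φ ξ x hx α z hz i

end Statements
end

section
/- Let L be a Leibniz superalgebra over K and M a module over L. Then the coboundary operators satisfy δⁿ⁺¹ ∘ δⁿ = 0 for all n ≥ 0; that is, (C*(L;M), δ) is a cochain complex. -/
open Finset

set_option linter.unusedSimpArgs false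
section Aux

variable {K : Type*} [Field K] {L : Type*} [AddCommGroup L] [Module K L]
  {M : Type*} [AddCommGroup M] [Module K M]
  (S : LeibnizSuperStruct K L) (MS : LeibnizSuperModule S M)

/-- The sign attached to a degree. -/
def sg (K : Type*) [Field K] (a : ZMod 2) : K := (-1 : K) ^ a.val

lemma sg_def (a : ZMod 2) : sg K a = (-1 : K) ^ a.val := rfl

lemma ite_neg_zero (p : Prop) [Decidable p] (m : M) :
    (if p then -m else 0) = -(if p then m else 0) := by
  split_ifs <;> simp

lemma sg_add (a b : ZMod 2) : sg K (a + b) = sg K a * sg K b := by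
  have h : ∀ a : ZMod 2, a = 0 ∨ a = 1 := by decide
  have h2 : (1 + 1 : ZMod 2) = 0 := by decide
  rcases h a with rfl | rfl <;> rcases h b with rfl | rfl <;> simp [sg, h2, ZMod.val_one]

lemma sg_sq (a : ZMod 2) : sg K a * sg K a = 1 := by
  rw [← sg_add, CharTwo.add_self_eq_zero]; simp [sg]

lemma sg_cases (a : ZMod 2) : sg K a = 1 ∨ sg K a = -1 :=
  mul_self_eq_one_iff.mp (sg_sq a)

lemma sg_mul (a b : ZMod 2) : (-1 : K) ^ (a.val * b.val) = sg K (a * b) := by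
  have h : ∀ a : ZMod 2, a = 0 ∨ a = 1 := by decide
  rcases h a with rfl | rfl <;> rcases h b with rfl | rfl <;> simp [sg, ZMod.val_one]

/-- Insertion of a first argument. -/
def ins {n : ℕ} (x : L) (ξ : ZMod 2) (g : (Fin (n + 1) → ZMod 2) → (Fin (n + 1) → L) → M) :
    (Fin n → ZMod 2) → (Fin n → L) → M :=
  fun α z => g (Fin.cons ξ α) (Fin.cons x z)

lemma removeNth_succ_cons' {A : Type*} {n : ℕ} (i : Fin (n + 1)) (a : A) (z : Fin (n + 1) → A) :
    i.succ.removeNth (Fin.cons a z : Fin (n + 2) → A)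
      = (Fin.cons a (i.removeNth z) : Fin (n + 1) → A) := by
  funext k
  refine Fin.cases ?_ (fun k => ?_) k
  · simp [Fin.removeNth]
  · simp [Fin.removeNth]

lemma init_cons' {A : Type*} {n : ℕ} (a : A) (z : Fin (n + 1) → A) :
    Fin.init (Fin.cons a z : Fin (n + 2) → A)
      = (Fin.cons a (Fin.init z) : Fin (n + 1) → A) := by
  funext k
  refine Fin.cases ?_ (fun k => ?_) k
  · simp [Fin.init]
  · simp only [Fin.init, Fin.castSucc_succ, Fin.cons_succ]

lemma Dop_cons {n : ℕ} (x y : L) (ξ η ψ : ZMod 2)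
    (g : (Fin (n + 1) → ZMod 2) → (Fin (n + 1) → L) → M) (α : Fin n → ZMod 2) (z : Fin n → L) :
    Dop S MS x ξ ψ g (Fin.cons η α) (Fin.cons y z) =
      Dop S MS x ξ (ψ + η) (ins y η g) α z
        - sg K (ξ * ψ) • ins (S.bracket x y) (ξ + η) g α z := by
  simp only [Dop, ins, sg, Fin.sum_univ_succ, Finset.sum_filter, Fin.cons_zero, Fin.cons_succ,
    Fin.update_cons_zero, ← Fin.cons_update, Fin.succ_lt_succ_iff, Fin.succ_pos, if_true,
    Fin.not_lt_zero, if_false, Finset.sum_const_zero, add_zero, add_assoc]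
  abel

lemma Delta_cons {n : ℕ} (x : L) (ξ ψ : ZMod 2)
    (g : (Fin (n + 1) → ZMod 2) → (Fin (n + 1) → L) → M)
    (α : Fin (n + 1) → ZMod 2) (z : Fin (n + 1) → L) :
    Delta S MS ψ g (Fin.cons ξ α) (Fin.cons x z) =
      sg K (ξ * ψ) • Dop S MS x ξ ψ g α z - Delta S MS (ψ + ξ) (ins x ξ g) α z := by
  have hD : sg K (ξ * ψ) • Dop S MS x ξ ψ g α z
      = sg K (ξ * ψ) • MS.lact x (g α z) - ∑ i : Fin (n + 1),
        (sg K (ξ * ∑ j, if j < i then α j else 0)) •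
          g (Function.update α i (ξ + α i)) (Function.update z i (S.bracket x (z i))) := by
    simp only [Dop, smul_sub, Finset.smul_sum, Finset.sum_filter, smul_smul]
    congr 1
    refine Finset.sum_congr rfl fun i _ => ?_
    congr 1
    rw [← sg, mul_add, sg_add, ← mul_assoc, sg_sq, one_mul]
  rw [hD]
  simp only [Delta, Finset.sum_filter]
  rw [Finset.sum_comm]
  conv_rhs => rw [Finset.sum_comm]
  rw [Fin.sum_univ_succ (n := n + 1)]
  simp only [Fin.sum_univ_succ (n := n + 1), Fin.cons_zero, Fin.cons_succ, ins,
    Fin.removeNth_zero, ← Fin.cons_update, Fin.tail_cons, removeNth_succ_cons', init_cons',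
    Fin.succ_lt_succ_iff, Fin.succ_pos, if_true, ← Fin.succ_last,
    Fin.not_lt_zero, if_false, Finset.sum_const_zero, add_zero, zero_add, true_and, false_and,
    lt_irrefl, Fin.val_succ, Fin.val_zero, Nat.zero_lt_succ, Nat.add_lt_add_iff_right, pow_zero,
    one_mul, pow_one, pow_succ, ← sg_def]
  simp only [mul_neg, neg_mul, mul_one, one_mul, neg_neg, neg_smul, ite_neg_zero,
    Finset.sum_neg_distrib, add_assoc]
  abel

lemma ins_Dop {n : ℕ} (x y : L) (ξ η ψ : ZMod 2)
    (f : MultilinearMap K (fun _ : Fin (n + 1) => L) M) :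
    ins y η (Dop S MS x ξ ψ (fun _ w => f w)) =
      (1 : K) • Dop S MS x ξ (ψ + η) (fun _ w => f.curryLeft y w)
        - sg K (ξ * ψ) • (fun _ w => f.curryLeft (S.bracket x y) w) := by
  funext α z
  rw [one_smul]
  exact Dop_cons S MS x y ξ η ψ _ α z

lemma ins_Delta {n : ℕ} (x : L) (ξ ψ : ZMod 2)
    (f : MultilinearMap K (fun _ : Fin (n + 1) => L) M) :
    ins x ξ (Delta S MS ψ (fun _ w => f w)) =
      sg K (ξ * ψ) • Dop S MS x ξ ψ (fun _ w => f w)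
        - (1 : K) • Delta S MS (ψ + ξ) (fun _ w => f.curryLeft x w) := by
  funext α z
  rw [one_smul]
  exact Delta_cons S MS x ξ ψ _ α z

lemma Dop_lin {n : ℕ} (x : L) (ξ ψ : ZMod 2) (a b : K)
    (g h : (Fin n → ZMod 2) → (Fin n → L) → M) (α : Fin n → ZMod 2) (z : Fin n → L) :
    Dop S MS x ξ ψ (a • g - b • h) α z
      = a • Dop S MS x ξ ψ g α z - b • Dop S MS x ξ ψ h α z := by
  simp only [Dop, Pi.sub_apply, Pi.smul_apply, map_sub, map_smul, smul_sub,
    Finset.sum_sub_distrib, Finset.smul_sum, smul_comm a, smul_comm b]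
  abel

lemma Delta_lin {n : ℕ} (ψ : ZMod 2) (a b : K)
    (g h : (Fin n → ZMod 2) → (Fin n → L) → M) (α : Fin (n + 1) → ZMod 2)
    (z : Fin (n + 1) → L) :
    Delta S MS ψ (a • g - b • h) α z
      = a • Delta S MS ψ g α z - b • Delta S MS ψ h α z := by
  simp only [Delta, Pi.sub_apply, Pi.smul_apply, map_sub, map_smul, smul_sub, smul_add,
    Finset.sum_sub_distrib, Finset.smul_sum, LinearMap.sub_apply, LinearMap.smul_apply,
    smul_comm a, smul_comm b]
  abel

lemma Dop_comm {x y : L} {ξ η : ZMod 2} (hx : x ∈ S.grading ξ) (hy : y ∈ S.grading η) :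
    ∀ (n : ℕ) (f : MultilinearMap K (fun _ : Fin n => L) M) (ψ : ZMod 2)
      (α : Fin n → ZMod 2) (z : Fin n → L),
      Dop S MS x ξ (ψ + η) (Dop S MS y η ψ (fun _ w => f w)) α z
        = sg K (ξ * η) • Dop S MS y η (ψ + ξ) (Dop S MS x ξ ψ (fun _ w => f w)) α z
          + Dop S MS (S.bracket x y) (ξ + η) ψ (fun _ w => f w) α z := by
  intro n
  induction n with
  | zero =>
    intro f ψ α z
    simp only [Dop, Finset.univ_eq_empty, Finset.sum_empty, sub_zero]
    rw [MS.leibniz_lact hx hy, sg_mul]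
    abel
  | succ n ih =>
    intro f ψ α z
    rw [← Fin.cons_self_tail α, ← Fin.cons_self_tail z]
    generalize Fin.tail α = α'
    generalize Fin.tail z = z'
    generalize α 0 = ω
    generalize z 0 = w
    have hL : f.curryLeft (S.bracket (S.bracket x y) w) z'
        = f.curryLeft (S.bracket x (S.bracket y w)) z'
          - sg K (ξ * η) • f.curryLeft (S.bracket y (S.bracket x w)) z' := by
      rw [S.leibniz hx hy, map_sub, map_smul, sg_mul]; rfl
    have ih' := ih (f.curryLeft w) (ψ + ω) α' z'
    have hc := Dop_cons S MS (S.bracket x y) w (ξ + η) ω ψ (fun _ w => f w) α' z'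
    rw [show ins (S.bracket (S.bracket x y) w) (ξ + η + ω) (fun _ w => f w) α' z'
      = f.curryLeft (S.bracket (S.bracket x y) w) z' from rfl, hL,
      show ins w ω (fun _ w => f w) = (fun _ v => f.curryLeft w v) from rfl] at hc
    rw [hc]
    simp only [Dop_cons, ins_Dop, Dop_lin, Pi.sub_apply, Pi.smul_apply]
    rw [add_right_comm ψ η ω, add_right_comm ψ ξ ω, ih']
    simp only [add_mul, mul_add, sg_add, mul_comm η ξ, ← add_assoc]
    simp only [add_right_comm ψ η ω, add_right_comm ψ ξ ω]
    rcases sg_cases (K := K) (ξ * η) with h1 | h1 <;> rw [h1] <;> module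

lemma homog_curry {n : ℕ} (f : MultilinearMap K (fun _ : Fin (n + 1) => L) M) (φ : ZMod 2)
    (hf : IsHomogeneousCochain S MS f φ) {x : L} {ξ : ZMod 2} (hx : x ∈ S.grading ξ) :
    IsHomogeneousCochain S MS (f.curryLeft x) (φ + ξ) := by
  intro α z hz
  have := hf (Fin.cons ξ α) (Fin.cons x z) (fun i => by
    refine Fin.cases ?_ (fun k => ?_) i
    · simpa using hx
    · simpa using hz k)
  rw [Fin.sum_univ_succ] at this
  simp only [Fin.cons_zero, Fin.cons_succ] at this
  rw [MultilinearMap.curryLeft_apply]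
  convert this using 2
  abel

lemma Dop_Delta {x : L} {ξ : ZMod 2} (hx : x ∈ S.grading ξ) :
    ∀ (n : ℕ) (f : MultilinearMap K (fun _ : Fin n => L) M) (ψ : ZMod 2)
      (_ : IsHomogeneousCochain S MS f ψ)
      (α : Fin (n + 1) → ZMod 2) (z : Fin (n + 1) → L) (_ : ∀ i, z i ∈ S.grading (α i)),
      Dop S MS x ξ ψ (Delta S MS ψ (fun _ w => f w)) α z
        = Delta S MS (ψ + ξ) (Dop S MS x ξ ψ (fun _ w => f w)) α z := by
  intro n
  induction n with
  | zero =>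
    intro f ψ hf α z hz
    have hm := hf (Fin.init α) (Fin.init z) (fun i => i.elim0)
    have e : ∀ v : Fin 0 → L, f v = f (Fin.init z) := fun v => by
      congr 1; exact Subsingleton.elim _ _
    simp only [Finset.univ_eq_empty, Finset.sum_empty, zero_add] at hm
    have := MS.leibniz_mid hx hm (z 0)
    rw [sg_mul] at this
    simp [Dop, Delta, Finset.sum_filter, ← sg_def, e, this]
    abel
  | succ n ih =>
    intro f ψ hf α z hz
    have hy := hz 0
    have hz' : ∀ i, Fin.tail z i ∈ S.grading (Fin.tail α i) := fun i => hz i.succ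
    rw [← Fin.cons_self_tail α, ← Fin.cons_self_tail z]
    revert hy hz'
    generalize Fin.tail α = α'
    generalize Fin.tail z = z'
    generalize α 0 = η
    generalize z 0 = y
    intro hy hz'
    have ih' := ih (f.curryLeft y) (ψ + η) (homog_curry S MS f ψ hf hy) α' z' hz'
    have hc := Dop_comm S MS hx hy (n + 1) f ψ α' z'
    simp only [Dop_cons, Delta_cons, ins_Dop, ins_Delta, Dop_lin, Delta_lin, Pi.sub_apply,
      Pi.smul_apply]
    rw [ih', hc]
    simp only [add_mul, mul_add, sg_add, mul_comm η ξ, ← add_assoc]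
    simp only [add_right_comm ψ η ξ]
    rcases sg_cases (K := K) (ξ * ψ) with h1 | h1 <;> rw [h1] <;> module

lemma Delta_Delta :
    ∀ (n : ℕ) (f : MultilinearMap K (fun _ : Fin n => L) M) (ψ : ZMod 2)
      (_ : IsHomogeneousCochain S MS f ψ)
      (α : Fin (n + 2) → ZMod 2) (z : Fin (n + 2) → L) (_ : ∀ i, z i ∈ S.grading (α i)),
      Delta S MS ψ (Delta S MS ψ (fun _ w => f w)) α z = 0 := by
  intro n
  induction n with
  | zero =>
    intro f ψ hf α z hz
    have hm := hf 0 0 (fun i => i.elim0)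
    have e : ∀ v : Fin 0 → L, f v = f 0 := fun v => by
      congr 1; exact Subsingleton.elim _ _
    simp only [Finset.univ_eq_empty, Finset.sum_empty, zero_add] at hm
    have := MS.leibniz_ract hm (hz 0) (z 1)
    rw [sg_mul] at this
    simp [Delta, Finset.sum_filter, ← sg_def, e, this, Fin.sum_univ_succ]
    have e1 : Fin.tail z 0 = z 1 := rfl
    have e2 : Fin.init z 0 = z 0 := rfl
    have e3 : sg K 0 = 1 := by simp [sg]
    rw [e1, e2, e3, this, mul_comm ψ]
    module
  | succ n ih =>
    intro f ψ hf α z hz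
    have hy := hz 0
    have hz' : ∀ i, Fin.tail z i ∈ S.grading (Fin.tail α i) := fun i => hz i.succ
    rw [← Fin.cons_self_tail α, ← Fin.cons_self_tail z]
    revert hy hz'
    generalize Fin.tail α = α'
    generalize Fin.tail z = z'
    generalize α 0 = η
    generalize z 0 = y
    intro hy hz'
    have ih' := ih (f.curryLeft y) (ψ + η) (homog_curry S MS f ψ hf hy) α' z' hz'
    have hc := Dop_Delta S MS hy (n + 1) f ψ hf α' z' hz'
    rw [Delta_cons, ins_Delta, Delta_lin, ih', hc]
    simp

end Aux

section Statements

variable {K : Type*} [Field K] {L : Type*} [AddCommGroup L] [Module K L]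
  {M : Type*} [AddCommGroup M] [Module K M]
  (S : LeibnizSuperStruct K L) (MS : LeibnizSuperModule S M)

theorem stmt4 (n : ℕ) (f : MultilinearMap K (fun _ : Fin n => L) M) (φ : ZMod 2)
    (hf : IsHomogeneousCochain S MS f φ)
    (α : Fin (n + 2) → ZMod 2) (x : Fin (n + 2) → L) (hx : ∀ i, x i ∈ S.grading (α i)) :
    Delta S MS φ (Delta S MS φ (fun _ w => f w)) α x = 0 :=
  Delta_Delta S MS n f φ hf α x hx

end Statements
end

section
/- Let L be a Leibniz superalgebra over K and M a module over L, regarded as an abelian Leibniz superalgebra. Every extension 0 → M →ⁱ 𝓔 →^π L → 0 of L by M (an exact sequence of Leibniz superalgebras with [x, i(m)] = [π(x), m] and [i(m), x] = [m, π(x)] for x ∈ 𝓔, m ∈ M) is equivalent to the extension E_h for some degree-0 2-cocycle h ∈ Z₀²(L;M). -/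
open Finset

theorem graded_lift_aux {K : Type*} [Field K] {A : Type*} [AddCommGroup A] [Module K A]
    {B : Type*} [AddCommGroup B] [Module K B]
    (GA : ZMod 2 → Submodule K A) (GB : ZMod 2 → Submodule K B)
    (hA : DirectSum.IsInternal GA) (hB : DirectSum.IsInternal GB) (f : A →ₗ[K] B)
    (hf : ∀ (α : ZMod 2) (a : A), a ∈ GA α → f a ∈ GB α)
    (α : ZMod 2) (a : A) (ha : f a ∈ GB α) : ∃ a' ∈ GA α, f a' = f a := by
  classical
  letI := hA.chooseDecomposition
  letI := hB.chooseDecomposition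
  have key : ∀ a : A, f (DirectSum.decompose GA a α : A) = (DirectSum.decompose GB (f a) α : B) := by
    intro a
    induction a using DirectSum.Decomposition.inductionOn GA with
    | zero => simp
    | @homogeneous β m =>
      by_cases hβ : β = α
      · subst hβ
        rw [DirectSum.decompose_of_mem_same GA m.2,
          DirectSum.decompose_of_mem_same GB (hf _ _ m.2)]
      · rw [DirectSum.decompose_of_mem_ne GA m.2 hβ,
          DirectSum.decompose_of_mem_ne GB (hf _ _ m.2) hβ, map_zero]
    | add m m' h h' => simp [DirectSum.decompose_add, h, h']
  exact ⟨_, (DirectSum.decompose GA a α).2, by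
    rw [key, DirectSum.decompose_of_mem_same GB ha]⟩

theorem graded_section_aux {K : Type*} [Field K] {A : Type*} [AddCommGroup A] [Module K A]
    {B : Type*} [AddCommGroup B] [Module K B]
    (GA : ZMod 2 → Submodule K A) (GB : ZMod 2 → Submodule K B)
    (hA : DirectSum.IsInternal GA) (hB : DirectSum.IsInternal GB) (f : A →ₗ[K] B)
    (hf : ∀ (α : ZMod 2) (a : A), a ∈ GA α → f a ∈ GB α) (hs : Function.Surjective f) :
    ∃ s : B →ₗ[K] A, (∀ b, f (s b) = b) ∧ ∀ (α : ZMod 2) (b : B), b ∈ GB α → s b ∈ GA α := by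
  classical
  have h1 : ∀ α, ∃ s : GB α →ₗ[K] GA α, ∀ b, f (s b : A) = b := by
    intro α
    have hsur : Function.Surjective (f.restrict (hf α)) := by
      rintro ⟨b, hb⟩
      obtain ⟨a, rfl⟩ := hs b
      obtain ⟨a', ha', h⟩ := graded_lift_aux GA GB hA hB f hf α a hb
      exact ⟨⟨a', ha'⟩, Subtype.ext h⟩
    obtain ⟨s, hs⟩ := LinearMap.exists_rightInverse_of_surjective _
      (LinearMap.range_eq_top.2 hsur)
    exact ⟨s, fun b => congrArg Subtype.val (LinearMap.congr_fun hs b)⟩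
  choose t ht using h1
  let e := LinearEquiv.ofBijective (DirectSum.coeLinearMap GB) hB
  let s : B →ₗ[K] A :=
    (DirectSum.toModule K (ZMod 2) A (fun α => (GA α).subtype ∘ₗ t α)) ∘ₗ e.symm.toLinearMap
  have hst : ∀ (α : ZMod 2) (b : GB α), s b = t α b := by
    intro α b
    have : e.symm (b : B) = DirectSum.lof K (ZMod 2) (fun α => GB α) α b := by
      rw [LinearEquiv.symm_apply_eq]
      exact (DirectSum.coeLinearMap_lof GB α b).symm
    simp [s, this]
  refine ⟨s, ?_, ?_⟩
  · intro b
    letI := hB.chooseDecomposition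
    induction b using DirectSum.Decomposition.inductionOn GB with
    | zero => simp
    | homogeneous m => rw [hst, ht]
    | add m m' h h' => rw [map_add, map_add, h, h']
  · intro α b hb
    rw [hst α ⟨b, hb⟩]
    exact (t α _).2

section Extensions

variable {K : Type*} [Field K] {L : Type*} [AddCommGroup L] [Module K L]
  {M : Type*} [AddCommGroup M] [Module K M]
  (S : LeibnizSuperStruct K L) (MS : LeibnizSuperModule S M)

/-- The bracket `[(x,m),(y,n)] = ([x,y], [x,n] + [m,y] + h(x,y))` on `𝓔 = L ⊕ M`. -/
def extBracket (h : L →ₗ[K] L →ₗ[K] M) : (L × M) →ₗ[K] (L × M) →ₗ[K] (L × M) :=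
  LinearMap.mk₂ K
    (fun p q => (S.bracket p.1 q.1, MS.lact p.1 q.2 + MS.ract p.2 q.1 + h p.1 q.1))
    (by intro p p' q; simp [Prod.ext_iff]; abel)
    (by intro c p q; simp [Prod.ext_iff, smul_add])
    (by intro p q q'; simp [Prod.ext_iff]; abel)
    (by intro c p q; simp [Prod.ext_iff, smul_add])

theorem stmt11 (E : Type*) [AddCommGroup E] [Module K E] (T : LeibnizSuperStruct K E)
    (i : M →ₗ[K] E) (p : E →ₗ[K] L)
    (hinj : Function.Injective i) (hsurj : Function.Surjective p)
    (hexact : LinearMap.range i = LinearMap.ker p)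
    (higr : ∀ (α : ZMod 2) (m : M), m ∈ MS.grading α → i m ∈ T.grading α)
    (hpgr : ∀ (α : ZMod 2) (e : E), e ∈ T.grading α → p e ∈ S.grading α)
    (hphom : ∀ a b : E, p (T.bracket a b) = S.bracket (p a) (p b))
    (hcompatl : ∀ (x : E) (m : M), T.bracket x (i m) = i (MS.lact (p x) m))
    (hcompatr : ∀ (m : M) (x : E), T.bracket (i m) x = i (MS.ract m (p x))) :
    ∃ h : L →ₗ[K] L →ₗ[K] M,
      (∀ (α β : ZMod 2) (x y : L), x ∈ S.grading α → y ∈ S.grading β →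
        h x y ∈ MS.grading (α + β))
      ∧ (∀ (α β : ZMod 2) (x₁ x₂ : L), x₁ ∈ S.grading α → x₂ ∈ S.grading β → ∀ x₃ : L,
          -(h (S.bracket x₁ x₂) x₃) - ((-1 : K) ^ (α.val * β.val)) • h x₂ (S.bracket x₁ x₃)
            + h x₁ (S.bracket x₂ x₃) + MS.lact x₁ (h x₂ x₃)
            - ((-1 : K) ^ (α.val * β.val)) • MS.lact x₂ (h x₁ x₃)
            - MS.ract (h x₁ x₂) x₃ = 0)
      ∧ ∃ ψ : (L × M) ≃ₗ[K] E,
          (∀ a b : L × M, ψ (extBracket S MS h a b) = T.bracket (ψ a) (ψ b))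
          ∧ (∀ m : M, ψ (0, m) = i m) ∧ ∀ q : L × M, p (ψ q) = q.1 := by
  obtain ⟨s, hps, hsgr⟩ :=
    graded_section_aux T.grading S.grading T.internal S.internal p hpgr hsurj
  have hpi : ∀ m, p (i m) = 0 := fun m => by
    have : i m ∈ LinearMap.ker p := hexact ▸ LinearMap.mem_range_self i m
    exact this
  have hbij : Function.Bijective (s.coprod i) := by
    constructor
    · rw [injective_iff_map_eq_zero]
      rintro ⟨x, m⟩ hx
      rw [LinearMap.coprod_apply] at hx
      have hx0 : x = 0 := by
        have := congrArg p hx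
        simpa [hps, hpi] using this
      subst hx0
      have : i m = i 0 := by simpa using hx
      rw [hinj this]
      rfl
    · intro e
      have : e - s (p e) ∈ LinearMap.range i := by
        rw [hexact]
        simp [hps]
      obtain ⟨m, hm⟩ := this
      exact ⟨(p e, m), by simp [hm]⟩
  let ψ : (L × M) ≃ₗ[K] E := LinearEquiv.ofBijective (s.coprod i) hbij
  have hψ : ∀ q : L × M, ψ q = s q.1 + i q.2 := fun q => by simp [ψ]
  let h : L →ₗ[K] L →ₗ[K] M :=
    (T.bracket.compl₁₂ s s).compr₂ ((LinearMap.snd K L M) ∘ₗ ψ.symm.toLinearMap)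
  have hpψ : ∀ q : L × M, p (ψ q) = q.1 := fun q => by simp [hψ, hps, hpi]
  have hh : ∀ x y, i (h x y) = T.bracket (s x) (s y) - s (S.bracket x y) := by
    intro x y
    have h1 := hψ (ψ.symm (T.bracket (s x) (s y)))
    have h2 := hpψ (ψ.symm (T.bracket (s x) (s y)))
    rw [LinearEquiv.apply_symm_apply] at h1 h2
    rw [← h2, hphom, hps, hps] at h1
    have h3 : h x y = (ψ.symm (T.bracket (s x) (s y))).2 := rfl
    rw [h3]
    exact eq_sub_of_add_eq' h1.symm
  refine ⟨h, ?_, ?_, ψ, ?_, ?_, hpψ⟩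
  · intro α β x y hx hy
    have hm : i (h x y) ∈ T.grading (α + β) := by
      rw [hh]
      exact Submodule.sub_mem _ (T.bracket_mem (hsgr _ _ hx) (hsgr _ _ hy))
        (hsgr _ _ (S.bracket_mem hx hy))
    obtain ⟨m, hm1, hm2⟩ :=
      graded_lift_aux MS.grading T.grading MS.internal T.internal i higr _ _ hm
    rwa [← hinj hm2]
  · intro α β x₁ x₂ hx₁ hx₂ x₃
    apply hinj
    have hl : ∀ x m, i (MS.lact x m) = T.bracket (s x) (i m) := fun x m => by
      rw [hcompatl, hps]
    have hr : ∀ x m, i (MS.ract m x) = T.bracket (i m) (s x) := fun x m => by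
      rw [hcompatr, hps]
    have hT := T.leibniz (hsgr _ _ hx₁) (hsgr _ _ hx₂) (s x₃)
    have hS := congrArg s (S.leibniz hx₁ hx₂ x₃)
    simp only [map_sub, map_smul] at hS
    simp only [map_add, map_sub, map_neg, map_smul, map_zero, hl, hr, hh, LinearMap.sub_apply,
      hT, hS, smul_sub]
    abel
  · rintro ⟨x, m⟩ ⟨y, n⟩
    have hz : T.bracket (i m) (i n) = 0 := by rw [hcompatl, hpi]; simp
    simp only [hψ, extBracket, LinearMap.mk₂_apply, map_add, LinearMap.add_apply, hh, hcompatl,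
      hcompatr, hps, hpi]
    simp
    abel
  · intro m
    simp [hψ]

end Extensions
end

section
/- Let A = A₀ ⊕ A₁ be an associative superalgebra over K and T : A → A a homogeneous linear map of degree 0 satisfying T(a·(Tb)) = (Ta)·(Tb) = T((Ta)·b) for all a, b ∈ A. Then the bracket [a,b] := (Ta)·b − (−1)^{|a||b|} b·(Ta), defined for homogeneous a, b ∈ A and extended bilinearly, makes A a Leibniz superalgebra: [A_α, A_β] ⊆ A_{α+β} and [[a,b],c] = [a,[b,c]] − (−1)^{|a||b|}[b,[a,c]] for all homogeneous a, b, c ∈ A. -/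
open Finset

/-- Projections onto the graded pieces of an internal direct sum. -/
theorem exists_proj_aux {K : Type*} [Field K] {A : Type*} [AddCommGroup A] [Module K A]
    (Ag : ZMod 2 → Submodule K A) (h : DirectSum.IsInternal Ag) :
    ∃ p : ZMod 2 → A →ₗ[K] A,
      (∀ i a, a ∈ Ag i → p i a = a) ∧ (∀ i j a, a ∈ Ag i → i ≠ j → p j a = 0) ∧
      (∀ i a, p i a ∈ Ag i) ∧ ∀ a, p 0 a + p 1 a = a := by
  classical
  letI := h.chooseDecomposition
  refine ⟨fun i => (Ag i).subtype ∘ₗ DirectSum.component K (ZMod 2) (fun i => Ag i) i ∘ₗ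
    (DirectSum.decomposeLinearEquiv Ag).toLinearMap, ?_, ?_, ?_, ?_⟩
  · intro i a ha
    exact DirectSum.decompose_of_mem_same Ag ha
  · intro i j a ha hij
    exact DirectSum.decompose_of_mem_ne Ag ha hij
  · intro i a
    exact Subtype.property _
  · intro a
    have := DirectSum.sum_support_decompose Ag a
    have h2 : ∑ i : ZMod 2, ((DirectSum.decompose Ag a i : Ag i) : A) = a := by
      conv_rhs => rw [← this]
      symm
      apply Finset.sum_subset (Finset.subset_univ _)
      intro x _ hx
      simpa using hx
    exact (Fin.sum_univ_two (fun i : Fin 2 =>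
      ((DirectSum.decompose Ag a (i : ZMod 2) : Ag i) : A))).symm.trans h2

theorem stmt13 (K : Type*) [Field K] (A : Type*) [NonUnitalRing A] [Module K A]
    [SMulCommClass K A A] [IsScalarTower K A A]
    (Ag : ZMod 2 → Submodule K A) (hinternal : DirectSum.IsInternal Ag)
    (hmul : ∀ {α β : ZMod 2} {a b : A}, a ∈ Ag α → b ∈ Ag β → a * b ∈ Ag (α + β))
    (T : A →ₗ[K] A) (hTdeg : ∀ (α : ZMod 2) (a : A), a ∈ Ag α → T a ∈ Ag α)
    (hT1 : ∀ a b : A, T (a * T b) = T a * T b)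
    (hT2 : ∀ a b : A, T a * T b = T (T a * b)) :
    (∀ (α β : ZMod 2) (a b : A), a ∈ Ag α → b ∈ Ag β →
      T a * b - ((-1 : K) ^ (α.val * β.val)) • (b * T a) ∈ Ag (α + β))
    ∧ ∃ St : LeibnizSuperStruct K A, St.grading = Ag ∧
        ∀ (α β : ZMod 2) (a b : A), a ∈ Ag α → b ∈ Ag β →
          St.bracket a b = T a * b - ((-1 : K) ^ (α.val * β.val)) • (b * T a) := by
  have hmem : ∀ (α β : ZMod 2) (a b : A), a ∈ Ag α → b ∈ Ag β →
      T a * b - ((-1 : K) ^ (α.val * β.val)) • (b * T a) ∈ Ag (α + β) := by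
    intro α β a b ha hb
    refine Submodule.sub_mem _ (hmul (hTdeg _ _ ha) hb) (Submodule.smul_mem _ _ ?_)
    rw [add_comm]
    exact hmul hb (hTdeg _ _ ha)
  refine ⟨hmem, ?_⟩
  obtain ⟨p, hp1, hp2, hp3, hp4⟩ := exists_proj_aux Ag hinternal
  let B : A →ₗ[K] A →ₗ[K] A :=
    (LinearMap.mul K A) ∘ₗ T - (LinearMap.mul K A).flip ∘ₗ T ∘ₗ p 0
      - ((LinearMap.mul K A).flip ∘ₗ T ∘ₗ p 1).compl₂ (p 0 - p 1)
  have hB0 : ∀ a b, B a b = T a * b - b * T (p 0 a) - (p 0 b - p 1 b) * T (p 1 a) := by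
    intro a b
    simp [B, sub_mul]
  have hz : ∀ α : ZMod 2, α = 0 ∨ α = 1 := by decide
  have v1 : (1 : ZMod 2).val = 1 := rfl
  have n01 : (0 : ZMod 2) ≠ 1 := by decide
  have hB : ∀ (α β : ZMod 2) (a b : A), a ∈ Ag α → b ∈ Ag β →
      B a b = T a * b - ((-1 : K) ^ (α.val * β.val)) • (b * T a) := by
    intro α β a b ha hb
    rw [hB0]
    rcases hz α with rfl | rfl <;> rcases hz β with rfl | rfl <;>
    first
      | simp [hp1 0 a ha, hp2 0 1 a ha n01, hp1 0 b hb, hp2 0 1 b hb n01, v1]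
      | simp [hp1 0 a ha, hp2 0 1 a ha n01, hp1 1 b hb, hp2 1 0 b hb n01.symm, v1]
      | simp [hp1 1 a ha, hp2 1 0 a ha n01.symm, hp1 0 b hb, hp2 0 1 b hb n01, v1]
      | simp [hp1 1 a ha, hp2 1 0 a ha n01.symm, hp1 1 b hb, hp2 1 0 b hb n01.symm, v1]
  have hBmem : ∀ (α β : ZMod 2) (a b : A), a ∈ Ag α → b ∈ Ag β → B a b ∈ Ag (α + β) := by
    intro α β a b ha hb
    rw [hB α β a b ha hb]
    exact hmem α β a b ha hb
  have hTB : ∀ (α β : ZMod 2) (a b : A), a ∈ Ag α → b ∈ Ag β →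
      T (B a b) = T a * T b - ((-1 : K) ^ (α.val * β.val)) • (T b * T a) := by
    intro α β a b ha hb
    rw [hB α β a b ha hb, map_sub, map_smul, hT1, ← hT2]
  have hL : ∀ (α β γ : ZMod 2) (a b c : A), a ∈ Ag α → b ∈ Ag β → c ∈ Ag γ →
      B (B a b) c = B a (B b c) - ((-1 : K) ^ (α.val * β.val)) • B b (B a c) := by
    intro α β γ a b c ha hb hc
    rw [hB (α + β) γ _ c (hBmem α β a b ha hb) hc, hTB α β a b ha hb,
      hB α (β + γ) a _ ha (hBmem β γ b c hb hc), hB β (α + γ) b _ hb (hBmem α γ a c ha hc),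
      hB β γ b c hb hc, hB α γ a c ha hc]
    have v2 : (1 + 1 : ZMod 2) = 0 := rfl
    rcases hz α with rfl | rfl <;> rcases hz β with rfl | rfl <;>
      rcases hz γ with rfl | rfl <;>
      simp only [v2, v1, ZMod.val_zero, add_zero, zero_add, mul_zero, zero_mul, mul_one,
        pow_zero, pow_one, one_smul, neg_smul] <;>
      noncomm_ring
  refine ⟨⟨Ag, hinternal, B, fun {α β a b} ha hb => hBmem α β a b ha hb, ?_⟩, rfl, hB⟩
  intro α β a b ha hb c
  have h0 := hL α β 0 a b _ ha hb (hp3 0 c)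
  have h1 := hL α β 1 a b _ ha hb (hp3 1 c)
  have h := congrArg₂ (· + ·) h0 h1
  rw [← hp4 c]
  simp only [map_add, smul_add] at h ⊢
  rw [h]
  abel
end
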